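/- arXiv:math/0208241 — 9 statements merged into one kernel-verified Lean document; each statement's English description precedes it below -/
import Mathlib

section
/- Let N be a ℚ-vector space with a symmetric bilinear form B and let H ∈ N be such that B is negative semidefinite on the subspace H^⊥ := {D ∈ N : B(D,H) = 0}. Equip V := ℚ × N × ℚ with the Mukai pairing. Let u = (r_u, c_u, b_u) and v = (r_v, c_v, b_v) be elements of V with r_u > 0, r_v > 0, ⟨v,v⟩ = 0, and B(c_u,H)/r_u = B(c_v,H)/r_v. Then r_v·⟨u,u⟩ ≤ 2·r_u·⟨u,v⟩. -/
/-- The Mukai pairing on `ℚ × N × ℚ` associated to a bilinear form `B` on `N`. -/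
def mukai {N : Type*} [AddCommGroup N] [Module ℚ N]
    (B : LinearMap.BilinForm ℚ N) (x y : ℚ × N × ℚ) : ℚ :=
  B x.2.1 y.2.1 - x.1 * y.2.2 - y.1 * x.2.2

theorem stmt_1 {N : Type*} [AddCommGroup N] [Module ℚ N]
    (B : LinearMap.BilinForm ℚ N) (hBsymm : ∀ D D' : N, B D D' = B D' D)
    (H : N) (hneg : ∀ D : N, B D H = 0 → B D D ≤ 0)
    (ru bu rv bv : ℚ) (cu cv : N)
    (u v : ℚ × N × ℚ) (hu : u = (ru, cu, bu)) (hv : v = (rv, cv, bv))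
    (hru : 0 < ru) (hrv : 0 < rv)
    (hvv : mukai B v v = 0)
    (hslope : B cu H / ru = B cv H / rv) :
    rv * mukai B u u ≤ 2 * ru * mukai B u v := by
  subst hu hv
  have horth : B (rv • cu - ru • cv) H = 0 := by
    rw [div_eq_div_iff hru.ne' hrv.ne'] at hslope
    simp only [map_sub, map_smul, LinearMap.sub_apply, LinearMap.smul_apply, smul_eq_mul]
    linarith
  have hsq := hneg _ horth
  simp only [map_sub, map_smul, LinearMap.sub_apply, LinearMap.smul_apply, smul_eq_mul,
    hBsymm cv cu] at hsq
  simp only [mukai] at hvv ⊢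
  refine le_of_mul_le_mul_left ?_ hrv
  linear_combination hsq - ru ^ 2 * hvv
end

section
/- Let N be a finite-dimensional ℚ-vector space with a symmetric bilinear form B and let H ∈ N be such that B is negative definite on H^⊥ := {D ∈ N : B(D,H) = 0}. Equip V := ℚ × N × ℚ with the Mukai pairing. Fix v = (r, ξ, a) ∈ V with r ≠ 0 and B(ξ,ξ) = 2ra (so ⟨v,v⟩ = 0), and set Ĥ := (0, H, B(H,ξ)/r). Then every u ∈ V with ⟨u,v⟩ = 0, ⟨u,Ĥ⟩ = 0 and u ∉ ℚv satisfies ⟨u,u⟩ < 0. In other words, the Mukai pairing induces a negative definite form on (Ĥ^⊥ ∩ v^⊥)/ℚv. -/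
theorem stmt_2 {N : Type*} [AddCommGroup N] [Module ℚ N] [FiniteDimensional ℚ N]
    (B : LinearMap.BilinForm ℚ N) (hBsymm : ∀ D D' : N, B D D' = B D' D)
    (H : N) (hneg : ∀ D : N, B D H = 0 → D ≠ 0 → B D D < 0)
    (r a : ℚ) (ξ : N) (hr : r ≠ 0) (hiso : B ξ ξ = 2 * r * a)
    (v Hhat : ℚ × N × ℚ) (hv : v = (r, ξ, a)) (hH : Hhat = (0, H, B H ξ / r)) :
    ∀ u : ℚ × N × ℚ, mukai B u v = 0 → mukai B u Hhat = 0 →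
      (∀ c : ℚ, u ≠ c • v) → mukai B u u < 0 := by
  rintro ⟨s, d, b⟩ huv huH hu
  subst hv hH
  obtain ⟨c, rfl⟩ : ∃ c, s = c * r := ⟨s / r, by field_simp⟩
  simp only [mukai] at huv huH ⊢
  have hDH : B (d - c • ξ) H = 0 := by
    have hcancel : c * r * (B H ξ / r) = c * B H ξ := by field_simp
    simp only [map_sub, map_smul, LinearMap.sub_apply, LinearMap.smul_apply, smul_eq_mul]
    linear_combination huH + hcancel - c * hBsymm ξ H
  have hD : d - c • ξ ≠ 0 := by
    intro h
    obtain rfl := sub_eq_zero.mp h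
    simp only [map_smul, LinearMap.smul_apply, smul_eq_mul] at huv
    have hb : b = c * a := mul_left_cancel₀ hr (by linear_combination c * hiso - huv)
    exact hu c (by simp [hb])
  have hDD := hneg _ hDH hD
  simp only [map_sub, map_smul, LinearMap.sub_apply, LinearMap.smul_apply, smul_eq_mul] at hDD
  rw [hBsymm ξ d] at hDD
  linear_combination hDD + 2 * c * huv - c ^ 2 * hiso
end

section
/- Let N be a free ℤ-module of finite rank with an integer-valued symmetric bilinear form B, and let H ∈ N be such that B is negative definite on the ℚ-subspace {D ∈ N ⊗ ℚ : B(D,H) = 0}. Equip M := ℤ × N × ℤ with the Mukai pairing. Fix v = (r, ξ, a) ∈ M with r > 0 and B(ξ,ξ) = 2ra. Then the set 𝒰 := { u = (s, c, b) ∈ M : ⟨u,u⟩ = −2, ⟨v,u⟩ ≤ 0, r·B(H,c) = s·B(H,ξ), 0 < s < r } is finite. -/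
open scoped TensorProduct

/-- The Mukai pairing on `ℤ × N × ℤ` associated to a bilinear form `B` on `N`. -/
def mukaiZ {N : Type*} [AddCommGroup N] [Module ℤ N]
    (B : LinearMap.BilinForm ℤ N) (x y : ℤ × N × ℤ) : ℤ :=
  B x.2.1 y.2.1 - x.1 * y.2.2 - y.1 * x.2.2

/-- An integral positive definite symmetric form on a finitely generated abelian group has only
finitely many vectors of bounded square. -/
theorem finite_setOf_apply_self_le {K : Type*} [AddCommGroup K] [Module ℤ K] [Module.Finite ℤ K]
    (Q : LinearMap.BilinForm ℤ K) (hsymm : ∀ x y, Q x y = Q y x)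
    (hpos : ∀ x, x ≠ 0 → 0 < Q x x) (C : ℤ) : {x : K | Q x x ≤ C}.Finite := by
  classical
  obtain ⟨S, hS⟩ := Module.Finite.fg_top (R := ℤ) (M := K)
  have hnonneg : ∀ x, 0 ≤ Q x x := fun x ↦ by
    rcases eq_or_ne x 0 with rfl | hx
    · simp
    · exact (hpos x hx).le
  let f : K → S → ℤ := fun x e ↦ Q x e
  let M : S → ℤ := fun e ↦ C * Q e e
  refine Set.Finite.of_finite_image (f := f) ((Set.finite_Icc (-M) M).subset ?_) ?_
  · rintro _ ⟨x, hx, rfl⟩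
    have hx' : Q x x ≤ C := hx
    have key : ∀ e : S, |Q x e| ≤ C * Q e e := fun e ↦ by
      have hcs := LinearMap.BilinForm.apply_mul_apply_le_of_forall_zero_le Q hnonneg x (e : K)
      rw [hsymm (e : K) x, ← sq] at hcs
      have hsq : |Q x e| ≤ Q x e ^ 2 := by
        rw [← Int.natCast_natAbs, ← Int.natAbs_sq]
        exact_mod_cast Nat.le_self_pow two_ne_zero _
      exact (hsq.trans hcs).trans (mul_le_mul_of_nonneg_right hx' (hnonneg e))
    exact ⟨fun e ↦ (abs_le.mp (key e)).1, fun e ↦ (abs_le.mp (key e)).2⟩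
  · intro x _ y _ hxy
    have hker : (⊤ : Submodule ℤ K) ≤ LinearMap.ker (Q (x - y)) := by
      rw [← hS, Submodule.span_le]
      intro e he
      have := congrFun hxy ⟨e, he⟩
      simpa [f, sub_eq_zero] using this
    by_contra hne
    have h0 : Q (x - y) (x - y) = 0 := hker (Submodule.mem_top (x := x - y))
    exact (hpos _ (sub_ne_zero.mpr hne)).ne' h0

theorem TensorProduct.one_tmul_rat_ne_zero {N : Type*} [AddCommGroup N] [Module ℤ N]
    [Module.Flat ℤ N] {D : N} (hD : D ≠ 0) : (1 : ℚ) ⊗ₜ[ℤ] D ≠ 0 := by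
  have hinj := Module.Flat.rTensor_preserves_injective_linearMap (M := N)
    (Algebra.linearMap ℤ ℚ) (algebraMap ℤ ℚ).injective_int
  intro h
  have h1 : (1 : ℤ) ⊗ₜ[ℤ] D = 0 := hinj (by simpa using h)
  exact hD (by simpa using congrArg (TensorProduct.lid ℤ N) h1)

theorem stmt_3 {N : Type*} [AddCommGroup N] [Module ℤ N]
    [Module.Free ℤ N] [Module.Finite ℤ N]
    (B : LinearMap.BilinForm ℤ N) (hBsymm : ∀ D D' : N, B D D' = B D' D)
    (H : N)
    (hneg : ∀ D : ℚ ⊗[ℤ] N, (B.baseChange ℚ) D ((1 : ℚ) ⊗ₜ[ℤ] H) = 0 → D ≠ 0 →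
      (B.baseChange ℚ) D D < 0)
    (r a : ℤ) (ξ : N) (hr : 0 < r) (hiso : B ξ ξ = 2 * r * a)
    (v : ℤ × N × ℤ) (hv : v = (r, ξ, a)) :
    Set.Finite {u : ℤ × N × ℤ | mukaiZ B u u = -2 ∧ mukaiZ B v u ≤ 0 ∧
      r * B H u.2.1 = u.1 * B H ξ ∧ 0 < u.1 ∧ u.1 < r} := by
  subst hv
  have hright : ∀ (n : ℤ) (x y : N), B x (n • y) = n * B x y := by simp
  have hleft : ∀ (n : ℤ) (x y : N), B (n • x) y = n * B x y := fun n x y ↦ by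
    rw [hBsymm, hright, hBsymm]
  have hnegZ : ∀ D : N, B H D = 0 → D ≠ 0 → B D D < 0 := fun D hD hD0 ↦ by
    have := hneg ((1 : ℚ) ⊗ₜ[ℤ] D)
      (by simp [LinearMap.BilinForm.baseChange_tmul, hBsymm D H, hD])
      (TensorProduct.one_tmul_rat_ne_zero hD0)
    simpa [LinearMap.BilinForm.baseChange_tmul] using this
  let K : Submodule ℤ N := LinearMap.ker (B H)
  let _ : Module ℤ K := K.module
  have hfin := finite_setOf_apply_self_le (-(B.restrict K))
    (fun x y ↦ by simp [hBsymm (x : N) y])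
    (fun x hx ↦ by
      have := hnegZ x x.2 (by simpa using hx)
      simpa using this) (2 * r ^ 2)
  let g : ℤ × N × ℤ → ℤ × N := fun u ↦ (u.1, r • u.2.1 - u.1 • ξ)
  refine Set.Finite.of_finite_image (f := g)
    (((Set.finite_Icc 0 r).prod (hfin.image Subtype.val)).subset ?_) ?_
  · rintro _ ⟨⟨s, c, b⟩, ⟨huu, hvu, hH, hs0, hsr⟩, rfl⟩
    simp only [mukaiZ] at huu hvu hH hs0 hsr
    refine ⟨⟨hs0.le, hsr.le⟩, ⟨r • c - s • ξ, ?_⟩, ?_, rfl⟩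
    · simp [K, hH]
    · have h1 := mul_le_mul_of_nonneg_left hvu (mul_pos hr hs0).le
      simp only [Set.mem_ofPred_eq, LinearMap.neg_apply, LinearMap.BilinForm.restrict_apply,
        LinearMap.domRestrict_apply, map_sub, LinearMap.sub_apply, hleft, hright,
        hBsymm c ξ, hiso]
      linear_combination 2 * h1 - r ^ 2 * huu
  · rintro ⟨s, c, b⟩ ⟨huu, -, -, hs0, -⟩ ⟨s', c', b'⟩ ⟨huu', -, -, -, -⟩ hg
    simp only [mukaiZ, g, Prod.mk.injEq] at huu huu' hs0 hg
    obtain ⟨rfl, hc⟩ := hg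
    obtain rfl : c = c' := smul_right_injective N hr.ne' <|
      (int_smul_eq_zsmul _ r c).trans <|
        (sub_left_inj.mp hc).trans (int_smul_eq_zsmul _ r c').symm
    obtain rfl : b = b' := mul_left_cancel₀ hs0.ne' (by linarith)
    rfl
end

section
/- Let N be a finite-dimensional ℚ-vector space with a symmetric bilinear form B taking even integer values on a lattice under consideration, precisely: equip M := ℤ × N' × ℤ with the Mukai pairing, where N' ⊆ N is a full lattice on which B is integer-valued and even (B(D,D) ∈ 2ℤ). Let H ∈ N be such that B is negative definite on {D ∈ N : B(D,H) = 0}. Let v = (r, ξ, a) ∈ M with r > 0 and ⟨v,v⟩ = 0 (i.e. B(ξ,ξ) = 2ra), and set Ĥ := (0, H, B(H,ξ)/r). Suppose u_1, …, u_s ∈ M satisfy: u_1 + ⋯ + u_s = v; each u_j has positive rank r_j > 0; ⟨Ĥ, u_j⟩ = 0 for every j; ⟨u_j, u_j⟩ ≥ −2 for every j; and no u_j is a ℚ-multiple of v. Then there exists an index i such that ⟨v, u_i⟩ ≤ 0 and ⟨u_i, u_i⟩ = −2. -/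
/-- The Mukai square of `u` and its pairing with an isotropic vector `(r, ξ, a)` are controlled by
the square of the rank-zero combination `r • u - u.1 • (r, ξ, a)`. -/
theorem apply_sub_smul_eq_mukai {N : Type*} [AddCommGroup N] [Module ℚ N]
    (B : LinearMap.BilinForm ℚ N) (hB : ∀ D D' : N, B D D' = B D' D)
    {r a : ℚ} {ξ : N} (hiso : B ξ ξ = 2 * r * a) (u : ℚ × N × ℚ) :
    B (r • u.2.1 - u.1 • ξ) (r • u.2.1 - u.1 • ξ) =
      r ^ 2 * mukai B u u - 2 * r * u.1 * mukai B (r, ξ, a) u := by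
  simp only [mukai, map_sub, map_smul, LinearMap.sub_apply, LinearMap.smul_apply, smul_eq_mul,
    hiso, hB u.2.1 ξ]
  ring

/-- A vector of positive rank with the same `H`-slope as an isotropic vector `v`, pairing
non-positively with `v` and not proportional to it, has negative Mukai square. -/
theorem mukai_self_neg_of_mukai_nonpos {N : Type*} [AddCommGroup N] [Module ℚ N]
    (B : LinearMap.BilinForm ℚ N) (hB : ∀ D D' : N, B D D' = B D' D)
    {H : N} (hneg : ∀ D : N, B D H = 0 → D ≠ 0 → B D D < 0)
    {r a : ℚ} {ξ : N} (hr : 0 < r) (hiso : B ξ ξ = 2 * r * a) {u : ℚ × N × ℚ} (hu : 0 < u.1)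
    (hslope : mukai B (0, H, B H ξ / r) u = 0)
    (hle : mukai B (r, ξ, a) u ≤ 0) (hnot : ∀ c : ℚ, u ≠ c • ((r, ξ, a) : ℚ × N × ℚ)) :
    mukai B u u < 0 := by
  have key := apply_sub_smul_eq_mukai B hB hiso u
  have horth : B (r • u.2.1 - u.1 • ξ) H = 0 := by
    simp only [mukai] at hslope
    simp only [map_sub, map_smul, LinearMap.sub_apply, LinearMap.smul_apply, smul_eq_mul,
      hB _ H]
    field_simp at hslope
    linarith
  have hr2 : 0 < r ^ 2 := by positivity
  have hru : 0 < 2 * r * u.1 := by positivity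
  have hprod := mul_nonpos_of_nonneg_of_nonpos hru.le hle
  by_contra! hsq
  have hsq' := mul_nonneg hr2.le hsq
  by_cases hD : r • u.2.1 - u.1 • ξ = 0
  · rw [hD, map_zero] at key
    have hzero : mukai B (r, ξ, a) u = 0 := by
      have : 2 * r * u.1 * mukai B (r, ξ, a) u = 0 := by linarith
      exact (mul_eq_zero.mp this).resolve_left hru.ne'
    have hc : u.2.1 = (u.1 / r) • ξ := by
      rw [div_eq_inv_mul, mul_smul, ← sub_eq_zero.mp hD, inv_smul_smul₀ hr.ne']
    apply hnot (u.1 / r)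
    refine Prod.ext ?_ (Prod.ext hc ?_)
    · simp [hr.ne']
    · simp only [mukai, hc, map_smul, smul_eq_mul, hiso] at hzero
      simp only [Prod.smul_snd, smul_eq_mul]
      field_simp at hzero ⊢
      linarith
  · linarith [hneg _ horth hD]

theorem stmt_4 {N : Type*} [AddCommGroup N] [Module ℚ N] [FiniteDimensional ℚ N]
    (B : LinearMap.BilinForm ℚ N) (hBsymm : ∀ D D' : N, B D D' = B D' D)
    -- `N'` is a full lattice in `N` on which `B` is integer-valued and even
    (N' : Submodule ℤ N)
    (hfull : Submodule.span ℚ (N' : Set N) = ⊤)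
    (hint : ∀ x ∈ N', ∀ y ∈ N', ∃ k : ℤ, B x y = (k : ℚ))
    (heven : ∀ x ∈ N', ∃ k : ℤ, B x x = 2 * (k : ℚ))
    -- the Hodge index hypothesis: `B` is negative definite on `H^⊥`
    (H : N) (hneg : ∀ D : N, B D H = 0 → D ≠ 0 → B D D < 0)
    -- the isotropic Mukai vector `v = (r, ξ, a)`
    (r a : ℤ) (ξ : N) (hξ : ξ ∈ N') (hr : 0 < r)
    (hiso : B ξ ξ = 2 * (r : ℚ) * (a : ℚ))
    (v Hhat : ℚ × N × ℚ) (hv : v = ((r : ℚ), ξ, (a : ℚ)))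
    (hH : Hhat = (0, H, B H ξ / (r : ℚ)))
    -- the inclusion of the integral Mukai lattice `ℤ × N' × ℤ` into `ℚ × N × ℚ`
    (e : ℤ × N × ℤ → ℚ × N × ℚ) (he : ∀ x, e x = ((x.1 : ℚ), x.2.1, (x.2.2 : ℚ)))
    -- the vectors `u_1, …, u_s`
    (s : ℕ) (hs : 0 < s) (u : Fin s → ℤ × N × ℤ)
    (hmem : ∀ j, (u j).2.1 ∈ N')
    (hsum : ∑ j, u j = (r, ξ, a))
    (hrk : ∀ j, 0 < (u j).1)
    (hHu : ∀ j, mukai B Hhat (e (u j)) = 0)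
    (hsq : ∀ j, -2 ≤ mukai B (e (u j)) (e (u j)))
    (hnotmul : ∀ j, ∀ c : ℚ, e (u j) ≠ c • v) :
    ∃ i, mukai B v (e (u i)) ≤ 0 ∧ mukai B (e (u i)) (e (u i)) = -2 := by
  obtain rfl : e = fun x => ((x.1 : ℚ), x.2.1, (x.2.2 : ℚ)) := funext he
  subst hv hH
  have hrank : ∑ j, (u j).1 = r := by simpa [Prod.fst_sum] using congrArg Prod.fst hsum
  have hclass : ∑ j, (u j).2.1 = ξ := by
    simpa [Prod.fst_sum, Prod.snd_sum] using congrArg (fun x => x.2.1) hsum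
  have hlast : ∑ j, (u j).2.2 = a := by
    simpa [Prod.snd_sum] using congrArg (fun x => x.2.2) hsum
  have htotal : ∑ j, mukai B ((r : ℚ), ξ, (a : ℚ)) ((u j).1, (u j).2.1, (u j).2.2) = 0 := by
    simp only [mukai, Finset.sum_sub_distrib, ← Finset.mul_sum, ← Finset.sum_mul, ← map_sum,
      ← Int.cast_sum, hrank, hclass, hlast, hiso]
    ring
  have : NeZero s := ⟨hs.ne'⟩
  obtain ⟨i, -, hi⟩ : ∃ i ∈ Finset.univ,
      mukai B ((r : ℚ), ξ, (a : ℚ)) ((u i).1, (u i).2.1, (u i).2.2) ≤ 0 :=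
    Finset.exists_le_of_sum_le Finset.univ_nonempty (by simpa using htotal.le)
  refine ⟨i, hi, ?_⟩
  have hlt := mukai_self_neg_of_mukai_nonpos B hBsymm hneg (by exact_mod_cast hr) hiso
    (Int.cast_pos.mpr (hrk i)) (hHu i) hi (hnotmul i)
  obtain ⟨k, hk⟩ := heven _ (hmem i)
  have hge := hsq i
  have hval : mukai B ((u i).1, (u i).2.1, (u i).2.2) ((u i).1, (u i).2.1, (u i).2.2) =
      ((2 * (k - (u i).1 * (u i).2.2) : ℤ) : ℚ) := by
    simp only [mukai, hk]
    push_cast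
    ring
  simp only [hval] at hlt hge ⊢
  have hlt' : 2 * (k - (u i).1 * (u i).2.2) < 0 := by exact_mod_cast hlt
  have hge' : -2 ≤ 2 * (k - (u i).1 * (u i).2.2) := by exact_mod_cast hge
  have : 2 * (k - (u i).1 * (u i).2.2) = -2 := by lia
  exact_mod_cast this
end

section
/- Let (a_{ij})_{i,j=0}^n be a symmetric integer matrix with associated form q(x,y) = Σ_{i,j} a_{ij} x_i y_j on ℤ^{n+1}, and let a_0, …, a_n be positive integers with a_0 = 1 such that δ := (a_0,…,a_n) satisfies q(δ, y) = 0 for every y. Assume that every m ∈ ℤ^{n+1} with m_0 = 0 and q(m,m) = 2 has all coordinates ≥ 0 or all coordinates ≤ 0, and satisfies |m_i| ≤ a_i for every i. Define Ψ₊ := { m ∈ ℤ^{n+1} : q(m,m) = 2, m_0 = 0, m_i ≥ 0 for all i }. Then { u ∈ ℤ^{n+1} : q(u,u) = 2, 0 < Σ_{i=0}^n u_i < Σ_{i=0}^n a_i } = Ψ₊ ∪ (δ − Ψ₊), and this union is disjoint. -/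
open Finset

/-- Adding a multiple of a radical vector to `±m` does not change the value of a quadratic form. -/
theorem sum_form_radical_add {ι : Type*} [Fintype ι] (a : ι → ι → ℤ)
    (hsymm : ∀ i j, a i j = a j i) (d : ι → ℤ)
    (hrad : ∀ y : ι → ℤ, ∑ i, ∑ j, a i j * d i * y j = 0) (c e : ℤ) (m : ι → ℤ) :
    ∑ i, ∑ j, a i j * (c * d i + e * m i) * (c * d j + e * m j)
      = e ^ 2 * ∑ i, ∑ j, a i j * m i * m j := by
  have hright : ∑ i, ∑ j, a i j * m i * d j = 0 := by
    rw [sum_comm, ← hrad m]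
    refine sum_congr rfl fun i _ => sum_congr rfl fun j _ => ?_
    rw [hsymm j i]
    ring
  calc
    _ = c ^ 2 * (∑ i, ∑ j, a i j * d i * d j) + c * e * (∑ i, ∑ j, a i j * d i * m j)
        + c * e * (∑ i, ∑ j, a i j * m i * d j) + e ^ 2 * ∑ i, ∑ j, a i j * m i * m j := by
      simp only [mul_sum, ← sum_add_distrib]
      exact sum_congr rfl fun i _ => sum_congr rfl fun j _ => by ring
    _ = _ := by rw [hrad d, hrad m, hright]; ring

theorem stmt_5 (n : ℕ) (a : Fin (n + 1) → Fin (n + 1) → ℤ)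
    (hsymm : ∀ i j, a i j = a j i)
    (q : (Fin (n + 1) → ℤ) → (Fin (n + 1) → ℤ) → ℤ)
    (hq : ∀ x y, q x y = ∑ i, ∑ j, a i j * x i * y j)
    (mark : Fin (n + 1) → ℤ) (hmark : ∀ i, 0 < mark i) (hmark0 : mark 0 = 1)
    (δ : Fin (n + 1) → ℤ) (hδ : δ = mark)
    (hrad : ∀ y, q δ y = 0)
    (hroot : ∀ m : Fin (n + 1) → ℤ, m 0 = 0 → q m m = 2 →
      ((∀ i, 0 ≤ m i) ∨ (∀ i, m i ≤ 0)) ∧ ∀ i, |m i| ≤ mark i)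
    (Ψ : Set (Fin (n + 1) → ℤ))
    (hΨ : Ψ = {m | q m m = 2 ∧ m 0 = 0 ∧ ∀ i, 0 ≤ m i}) :
    {u : Fin (n + 1) → ℤ | q u u = 2 ∧ 0 < ∑ i, u i ∧ ∑ i, u i < ∑ i, mark i}
      = Ψ ∪ ((fun m => δ - m) '' Ψ) ∧
    Disjoint Ψ ((fun m => δ - m) '' Ψ) := by
  subst hδ
  have hform (c e : ℤ) (m : Fin (n + 1) → ℤ) :
      q (fun i => c * δ i + e * m i) (fun i => c * δ i + e * m i) = e ^ 2 * q m m := by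
    simp only [hq] at hrad ⊢
    exact sum_form_radical_add a hsymm δ hrad c e m
  have hq_sub (m : Fin (n + 1) → ℤ) : q (δ - m) (δ - m) = q m m := by
    have h : (δ - m) = fun i => 1 * δ i + (-1) * m i := by
      funext i
      simp [sub_eq_add_neg]
    rw [h, hform]
    ring
  have hbounds (m : Fin (n + 1) → ℤ) (hm : m ∈ Ψ) : 0 < ∑ i, m i ∧ ∑ i, m i < ∑ i, δ i := by
    rw [hΨ] at hm
    obtain ⟨hm2, hm0, hnn⟩ := hm
    constructor
    · refine (sum_nonneg fun i _ => hnn i).lt_of_ne fun hsum => ?_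
      have hzero := (sum_eq_zero_iff_of_nonneg fun i _ => hnn i).1 hsum.symm
      simp [hq, fun i => hzero i (mem_univ i)] at hm2
    · refine sum_lt_sum (fun i _ => (le_abs_self _).trans ((hroot m hm0 hm2).2 i))
        ⟨0, mem_univ 0, ?_⟩
      rw [hm0]
      exact hmark 0
  refine ⟨?_, ?_⟩
  · ext u
    constructor
    · rintro ⟨hu2, hpos, hlt⟩
      set m : Fin (n + 1) → ℤ := fun i => -u 0 * δ i + 1 * u i with hm
      have hm2 : q m m = 2 := by rw [hm, hform, hu2]; norm_num
      have hm0 : m 0 = 0 := by simp [hm, hmark0]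
      have hsum : ∑ i, m i = -u 0 * ∑ i, δ i + ∑ i, u i := by
        simp [hm, sum_add_distrib, mul_sum]
      rcases (hroot m hm0 hm2).1 with hnn | hnp
      · have hmΨ : m ∈ Ψ := by rw [hΨ]; exact ⟨hm2, hm0, hnn⟩
        obtain ⟨h1, h2⟩ := hbounds m hmΨ
        have hlow : -1 < u 0 := by nlinarith
        have hupp : u 0 < 1 := by nlinarith
        have hu0 : u 0 = 0 := by omega
        have hmu : m = u := by funext i; simp [hm, hu0]
        exact Or.inl (hmu ▸ hmΨ)
      · have hmΨ : -m ∈ Ψ := by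
          rw [hΨ]
          refine ⟨?_, by simp [hm0], fun i => by simpa using hnp i⟩
          have h : -m = fun i => 0 * δ i + (-1) * m i := by funext i; simp
          rw [h, hform, hm2]
          norm_num
        obtain ⟨h1, h2⟩ := hbounds (-m) hmΨ
        simp only [Pi.neg_apply, sum_neg_distrib] at h1 h2
        have hlow : 0 < u 0 := by nlinarith
        have hupp : u 0 < 2 := by nlinarith
        have hu0 : u 0 = 1 := by omega
        refine Or.inr ⟨-m, hmΨ, ?_⟩
        funext i
        simp [hm, hu0]
    · rintro (hu | ⟨m, hm, rfl⟩)
      · obtain ⟨h1, h2⟩ := hbounds u hu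
        rw [hΨ] at hu
        exact ⟨hu.1, h1, h2⟩
      · obtain ⟨h1, h2⟩ := hbounds m hm
        rw [hΨ] at hm
        refine ⟨(hq_sub m).trans hm.1, ?_, ?_⟩ <;>
        · simp only [Pi.sub_apply, sum_sub_distrib]
          linarith
  · rw [Set.disjoint_left]
    rintro _ hu ⟨m, hm, rfl⟩
    rw [hΨ] at hu hm
    have h0 : δ 0 - m 0 = 0 := hu.2.1
    rw [hm.2.1, hmark0] at h0
    norm_num at h0
end

section
/- Let (A, 𝔪) and (B, 𝔫) be Noetherian commutative local rings and f : A → B a local ring homomorphism. Let x ∈ 𝔪 be a non-zero-divisor of A such that: (i) the quotient ring B/xB is reduced (equivalently, xB = 𝔭₁ ∩ ⋯ ∩ 𝔭_n is an intersection of finitely many prime ideals 𝔭₁, …, 𝔭_n of B); and (ii) for each of these primes 𝔭_i, the localization B_{𝔭_i} is flat as an A-module (via f). Then f(x) is a non-zero-divisor of B. -/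
/-- If `t` is a regular element of `B_𝔭` for the minimal primes
`𝔭` of a radical ideal `(t)`, then `t`-power torsion is contained in every power of `(t)`. -/
theorem mem_span_singleton_pow_of_pow_mul_eq_zero {B : Type*} [CommRing B] {t : B}
    (hrad : (Ideal.span {t}).IsRadical)
    (hreg : ∀ 𝔭 ∈ (Ideal.span ({t} : Set B)).minimalPrimes, ∀ _ : 𝔭.IsPrime,
      algebraMap B (Localization.AtPrime 𝔭) t ∈ nonZeroDivisors (Localization.AtPrime 𝔭))
    (n : ℕ) {k : ℕ} {b : B} (hb : t ^ k * b = 0) : b ∈ Ideal.span {t} ^ n := by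
  induction n generalizing k b with
  | zero => simp
  | succ n ih =>
    have hbt : b ∈ Ideal.span {t} := by
      rw [← hrad.radical, ← Ideal.sInf_minimalPrimes, Submodule.mem_sInf]
      intro (𝔭 : Ideal B) (h𝔭 : 𝔭 ∈ (Ideal.span {t}).minimalPrimes)
      have hprime : 𝔭.IsPrime := h𝔭.1.1
      have hloc : algebraMap B (Localization.AtPrime 𝔭) b = 0 := by
        refine (mul_left_mem_nonZeroDivisors_eq_zero_iff (pow_mem (hreg 𝔭 h𝔭 hprime) k)).1 ?_
        rw [← map_pow, ← map_mul, hb, map_zero]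
      obtain ⟨s, hs⟩ := (IsLocalization.map_eq_zero_iff 𝔭.primeCompl _ b).1 hloc
      exact (hprime.mem_or_mem (hs ▸ 𝔭.zero_mem : (s : B) * b ∈ 𝔭)).resolve_left s.2
    obtain ⟨c, rfl⟩ := Ideal.mem_span_singleton'.1 hbt
    rw [pow_succ]
    refine Ideal.mul_mem_mul (ih (k := k + 1) ?_) (Ideal.mem_span_singleton_self t)
    rw [← hb]
    ring

theorem stmt_6 {A B : Type*} [CommRing A] [CommRing B]
    [IsNoetherianRing A] [IsNoetherianRing B]
    [IsLocalRing A] [IsLocalRing B]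
    (f : A →+* B) (hf : IsLocalHom f)
    (x : A) (hxm : x ∈ IsLocalRing.maximalIdeal A)
    (hxreg : x ∈ nonZeroDivisors A)
    (hred : IsReduced (B ⧸ Ideal.span {f x}))
    (hflat : ∀ 𝔭 ∈ (Ideal.span ({f x} : Set B)).minimalPrimes, ∀ hp : 𝔭.IsPrime,
      letI : Algebra A (Localization.AtPrime 𝔭) :=
        ((algebraMap B (Localization.AtPrime 𝔭)).comp f).toAlgebra
      Module.Flat A (Localization.AtPrime 𝔭)) :
    f x ∈ nonZeroDivisors B := by
  have hrad : (Ideal.span {f x}).IsRadical :=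
    (Ideal.isRadical_iff_quotient_reduced _).2 hred
  have hreg : ∀ 𝔭 ∈ (Ideal.span ({f x} : Set B)).minimalPrimes, ∀ _ : 𝔭.IsPrime,
      algebraMap B (Localization.AtPrime 𝔭) (f x) ∈
        nonZeroDivisors (Localization.AtPrime 𝔭) := by
    intro 𝔭 h𝔭 hprime
    let _ : Algebra A (Localization.AtPrime 𝔭) :=
      ((algebraMap B (Localization.AtPrime 𝔭)).comp f).toAlgebra
    have hfl : Module.Flat A (Localization.AtPrime 𝔭) := hflat 𝔭 h𝔭 hprime
    have hs : IsSMulRegular (Localization.AtPrime 𝔭) x :=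
      Module.Flat.isSMulRegular_of_nonZeroDivisors hxreg
    rw [mem_nonZeroDivisors_iff_right]
    intro z hz
    refine hs.right_eq_zero_of_smul ?_
    rw [Algebra.smul_def, mul_comm]
    exact hz
  have hne : Ideal.span {f x} ≠ ⊤ := by
    rw [Ne, Ideal.span_singleton_eq_top]
    exact fun h => hxm (hf.map_nonunit x h)
  rw [mem_nonZeroDivisors_iff_right]
  intro b hb
  rw [← Ideal.mem_bot, ← Ideal.iInf_pow_eq_bot_of_isLocalRing _ hne, Ideal.mem_iInf]
  exact fun n => mem_span_singleton_pow_of_pow_mul_eq_zero hrad hreg n (k := 1)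
    (by rw [pow_one, mul_comm, hb])
end

section
/- Let L be a free ℤ-module of finite rank with a symmetric bilinear form ⟨·,·⟩. Let β_0, …, β_n, σ be linearly independent elements of L with ⟨σ,σ⟩ = 0, ⟨σ,β_0⟩ = 1, ⟨σ,β_i⟩ = 0 for i > 0, and ⟨β_i,β_j⟩ = −a_{ij} for a given symmetric integer matrix (a_{ij})_{i,j=0}^n. Suppose x ∈ L satisfies ⟨x,β_i⟩ = 0 for all i, ⟨x,σ⟩ = 0, and ⟨x,x⟩ = 2d with d > 0. Set ξ_i := β_i + x for 0 ≤ i ≤ n. Then ⟨ξ_i,ξ_j⟩ = −a_{ij} + 2d for all i, j, and ξ_0, …, ξ_n are linearly independent over ℤ. -/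
/-- Translating a linearly independent family by a vector `x` keeps it linearly independent when some
linear form kills the family but not `x`. -/
theorem LinearIndependent.add_const_of_apply_eq_zero {ι R M : Type*} [CommRing R] [NoZeroDivisors R]
    [AddCommGroup M] [Module R M] {v : ι → M} (hv : LinearIndependent R v) {x : M}
    (f : M →ₗ[R] R) (hfv : ∀ i, f (v i) = 0) (hfx : f x ≠ 0) :
    LinearIndependent R (fun i => v i + x) := by
  rw [linearIndependent_iff'] at hv ⊢
  intro s c hc
  simp only [smul_add, Finset.sum_add_distrib, ← Finset.sum_smul] at hc
  have hsum : ∑ i ∈ s, c i = 0 := by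
    have h := congrArg f hc
    simpa [hfv, hfx] using h
  exact hv s c (by simpa [hsum] using hc)


theorem stmt_7 {L : Type*} [AddCommGroup L] [Module ℤ L]
    [Module.Free ℤ L] [Module.Finite ℤ L]
    (b : LinearMap.BilinForm ℤ L) (hbsymm : ∀ x y : L, b x y = b y x)
    (n : ℕ) (a : Fin (n + 1) → Fin (n + 1) → ℤ) (hasymm : ∀ i j, a i j = a j i)
    (β : Fin (n + 1) → L) (σ : L)
    (hindep : LinearIndependent ℤ (Fin.snoc β σ : Fin (n + 2) → L))
    (hσσ : b σ σ = 0) (hσβ0 : b σ (β 0) = 1)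
    (hσβ : ∀ i : Fin (n + 1), i ≠ 0 → b σ (β i) = 0)
    (hββ : ∀ i j, b (β i) (β j) = -a i j)
    (x : L) (hxβ : ∀ i, b x (β i) = 0) (hxσ : b x σ = 0)
    (d : ℤ) (hd : 0 < d) (hxx : b x x = 2 * d)
    (ξ : Fin (n + 1) → L) (hξ : ∀ i, ξ i = β i + x) :
    (∀ i j, b (ξ i) (ξ j) = -a i j + 2 * d) ∧ LinearIndependent ℤ ξ := by
  obtain rfl : ξ = fun i => β i + x := funext hξ
  refine ⟨fun i j => ?_, ?_⟩
  · simp [hββ, hxβ, hxx, hbsymm (β i) x]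
  · have hβ : LinearIndependent ℤ β := by
      simpa [Function.comp_def] using hindep.comp Fin.castSucc (Fin.castSucc_injective _)
    exact hβ.add_const_of_apply_eq_zero (b x) hxβ (by omega)
end

section
/- Let (a_{ij})_{i,j=0}^n be a symmetric integer matrix with associated form q(x,y) = Σ_{i,j} a_{ij} x_i y_j on ℤ^{n+1}, and let a_0, …, a_n be positive integers with a_0 = 1 such that δ := (a_0,…,a_n) satisfies q(δ, y) = 0 for every y. Assume that every m ∈ ℤ^{n+1} with m_0 = 0 and q(m,m) = 2 has all coordinates ≥ 0 or all coordinates ≤ 0, and satisfies |m_i| ≤ a_i for every i. Then there is no x ∈ ℤ^{n+1} with q(x,x) = 2 and Σ_{i=0}^n x_i = 0. -/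
open Finset

/-- An integer vector of constant sign, vanishing at some `i₀` with `0 < b i₀` and bounded by `b`,
is zero as soon as its sum is a multiple of the sum of `b`. -/
theorem eq_zero_of_sum_dvd_sum {ι : Type*} [Fintype ι] {b m : ι → ℤ} (i₀ : ι)
    (hb : 0 < b i₀) (hm₀ : m i₀ = 0)
    (hsign : (∀ i, 0 ≤ m i) ∨ (∀ i, m i ≤ 0)) (hle : ∀ i, |m i| ≤ b i)
    (hdvd : ∑ i, b i ∣ ∑ i, m i) : m = 0 := by
  have habs : ∑ i, |m i| < ∑ i, b i :=
    Finset.sum_lt_sum (fun i _ => hle i) ⟨i₀, Finset.mem_univ _, by simpa [hm₀] using hb⟩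
  have hsum : ∑ i, m i = 0 :=
    Int.eq_zero_of_abs_lt_dvd hdvd ((Finset.abs_sum_le_sum_abs _ _).trans_lt habs)
  funext i
  rcases hsign with h | h
  · exact (Finset.sum_eq_zero_iff_of_nonneg fun i _ => h i).1 hsum i (Finset.mem_univ i)
  · exact (Finset.sum_eq_zero_iff_of_nonpos fun i _ => h i).1 hsum i (Finset.mem_univ i)

theorem stmt_12 (n : ℕ) (a : Fin (n + 1) → Fin (n + 1) → ℤ)
    (hsymm : ∀ i j, a i j = a j i)
    (q : (Fin (n + 1) → ℤ) → (Fin (n + 1) → ℤ) → ℤ)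
    (hq : ∀ x y, q x y = ∑ i, ∑ j, a i j * x i * y j)
    (mark : Fin (n + 1) → ℤ) (hmark : ∀ i, 0 < mark i) (hmark0 : mark 0 = 1)
    (δ : Fin (n + 1) → ℤ) (hδ : δ = mark)
    (hrad : ∀ y, q δ y = 0)
    (hroot : ∀ m : Fin (n + 1) → ℤ, m 0 = 0 → q m m = 2 →
      ((∀ i, 0 ≤ m i) ∨ (∀ i, m i ≤ 0)) ∧ ∀ i, |m i| ≤ mark i) :
    ¬∃ x : Fin (n + 1) → ℤ, q x x = 2 ∧ ∑ i, x i = 0 := by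
  subst hδ
  rintro ⟨x, hx, hsum⟩
  have hcomm : ∀ y z, q y z = q z y := fun y z => by
    rw [hq, hq, Finset.sum_comm]
    exact Finset.sum_congr rfl fun i _ => Finset.sum_congr rfl fun j _ => by
      rw [hsymm j i]; ring
  have hshift : ∀ y z, q (y - x 0 • δ) z = q y z := fun y z => by
    have h : q (y - x 0 • δ) z = q y z - x 0 * q δ z := by
      simp only [hq, Finset.mul_sum, ← Finset.sum_sub_distrib]
      exact Finset.sum_congr rfl fun i _ => Finset.sum_congr rfl fun j _ => by
        simp only [Pi.sub_apply, Pi.smul_apply, smul_eq_mul]; ring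
    rw [h, hrad, mul_zero, sub_zero]
  have hm₀ : (x - x 0 • δ) 0 = 0 := by simp [hmark0]
  have hm : q (x - x 0 • δ) (x - x 0 • δ) = 2 := by rw [hshift, hcomm, hshift, hx]
  obtain ⟨hsign, hle⟩ := hroot _ hm₀ hm
  have hdvd : ∑ i, δ i ∣ ∑ i, (x - x 0 • δ) i :=
    ⟨-x 0, by simp [Finset.sum_sub_distrib, hsum, Finset.sum_mul, mul_comm]⟩
  rw [eq_zero_of_sum_dvd_sum 0 (hmark 0) hm₀ hsign hle hdvd, hq] at hm
  simp at hm
end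

section
/- Let (a_{ij})_{i,j=0}^n be a symmetric integer matrix whose form q(x,y) = Σ a_{ij} x_i y_j is positive semidefinite, let a_0, …, a_n be positive integers with a_0 = 1 and Σ_i a_i a_{ij} = 0 for all j, suppose every x ∈ ℚ^{n+1} with q(x,x) = 0 is a ℚ-multiple of δ := (a_0,…,a_n), and suppose every m ∈ ℤ^{n+1} with m_0 = 0 and q(m,m) = 2 has all coordinates ≥ 0 or all ≤ 0 with |m_i| ≤ a_i for all i. Let r, a be positive integers, equip ℤ^{n+1} with the form B(ξ_i,ξ_j) = −a_{ij} + 2ra, and set H := Σ_i a_i ξ_i. Then H^⊥ := { x ∈ ℤ^{n+1} : B(x,H) = 0 } is negative definite for B (B(x,x) < 0 for all nonzero x ∈ H^⊥), and H^⊥ contains no vector x with B(x,x) = −2. -/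
open Finset

/-- Rewriting a rank-one perturbation of a bilinear form. -/
lemma sum_mul_neg_add_const {ι : Type*} [Fintype ι] (a : ι → ι → ℤ) (c : ℤ) (x y : ι → ℤ) :
    ∑ i, ∑ j, x i * y j * (-a i j + c) =
      c * ((∑ i, x i) * ∑ j, y j) - ∑ i, ∑ j, a i j * x i * y j := by
  rw [Finset.sum_mul_sum, Finset.mul_sum, ← Finset.sum_sub_distrib]
  refine Finset.sum_congr rfl fun i _ => ?_
  rw [Finset.mul_sum, ← Finset.sum_sub_distrib]
  exact Finset.sum_congr rfl fun j _ => by ring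

/-- A vector in the kernel of a symmetric form pairs to zero on the right. -/
lemma sum_mul_radical_right {ι : Type*} [Fintype ι] {a : ι → ι → ℤ}
    (hsymm : ∀ i j, a i j = a j i) {δ : ι → ℤ} (hδ : ∀ j, ∑ i, δ i * a i j = 0) (x : ι → ℤ) :
    ∑ i, ∑ j, a i j * x i * δ j = 0 := by
  refine Finset.sum_eq_zero fun i _ => ?_
  calc ∑ j, a i j * x i * δ j = x i * ∑ j, δ j * a j i := by
        rw [Finset.mul_sum]
        exact Finset.sum_congr rfl fun j _ => by rw [hsymm i j]; ring
    _ = 0 := by rw [hδ, mul_zero]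

/-- The quadratic form is invariant under translation by radical vectors. -/
lemma sum_sub_mul_radical {ι : Type*} [Fintype ι] {a : ι → ι → ℤ}
    (hsymm : ∀ i j, a i j = a j i) {δ : ι → ℤ} (hδ : ∀ j, ∑ i, δ i * a i j = 0)
    (x : ι → ℤ) (c : ℤ) :
    ∑ i, ∑ j, a i j * (x i - c * δ i) * (x j - c * δ j) = ∑ i, ∑ j, a i j * x i * x j := by
  have hright := sum_mul_radical_right hsymm hδ
  have hleft : ∑ i, ∑ j, a i j * δ i * x j = 0 := by
    rw [Finset.sum_comm, ← hright x]
    exact Finset.sum_congr rfl fun i _ => Finset.sum_congr rfl fun j _ => by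
      rw [hsymm j i]; ring
  have expand : ∑ i, ∑ j, a i j * (x i - c * δ i) * (x j - c * δ j) =
      ∑ i, ∑ j, a i j * x i * x j - c * ∑ i, ∑ j, a i j * x i * δ j
        - c * ∑ i, ∑ j, a i j * δ i * x j + c ^ 2 * ∑ i, ∑ j, a i j * δ i * δ j := by
    simp only [Finset.mul_sum, ← Finset.sum_sub_distrib, ← Finset.sum_add_distrib]
    exact Finset.sum_congr rfl fun i _ => Finset.sum_congr rfl fun j _ => by ring
  rw [expand, hright x, hright δ, hleft]
  ring

/-- If `x` has coordinate sum zero and its translate `x - x i₀ • δ` is bounded in absolute value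
by `δ` and has coordinates of constant sign, then `x = 0`. -/
lemma eq_zero_of_sum_eq_zero_of_sub_mul_bounded {ι : Type*} [Fintype ι] {δ x : ι → ℤ} {i₀ : ι}
    (hδ₀ : δ i₀ = 1) (hδ : ∀ i, 0 < δ i) (hx : ∑ i, x i = 0)
    (hsign : (∀ i, 0 ≤ x i - x i₀ * δ i) ∨ ∀ i, x i - x i₀ * δ i ≤ 0)
    (hbound : ∀ i, |x i - x i₀ * δ i| ≤ δ i) : x = 0 := by
  have hsum : ∑ i, (x i - x i₀ * δ i) = -(x i₀ * ∑ i, δ i) := by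
    rw [Finset.sum_sub_distrib, hx, ← Finset.mul_sum, zero_sub]
  have hpos : 0 < ∑ i, δ i := Finset.sum_pos (fun i _ => hδ i) ⟨i₀, Finset.mem_univ _⟩
  have habs : |x i₀| * ∑ i, δ i < ∑ i, δ i := by
    calc |x i₀| * ∑ i, δ i = |∑ i, (x i - x i₀ * δ i)| := by
          rw [hsum, abs_neg, abs_mul, abs_of_pos hpos]
      _ ≤ ∑ i, |x i - x i₀ * δ i| := Finset.abs_sum_le_sum_abs _ _
      _ < ∑ i, δ i := Finset.sum_lt_sum (fun i _ => hbound i)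
          ⟨i₀, Finset.mem_univ _, by simp [hδ₀]⟩
  have hx₀ : x i₀ = 0 := Int.abs_lt_one_iff.mp (by nlinarith)
  simp only [hx₀, zero_mul, sub_zero] at hsign
  funext i
  rcases hsign with h | h
  · exact (Finset.sum_eq_zero_iff_of_nonneg fun i _ => h i).mp hx i (Finset.mem_univ i)
  · exact (Finset.sum_eq_zero_iff_of_nonpos fun i _ => h i).mp hx i (Finset.mem_univ i)

theorem stmt_13 (n : ℕ) (a : Fin (n + 1) → Fin (n + 1) → ℤ)
    (hsymm : ∀ i j, a i j = a j i)
    (qQ : (Fin (n + 1) → ℚ) → (Fin (n + 1) → ℚ) → ℚ)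
    (hqQ : ∀ x y, qQ x y = ∑ i, ∑ j, (a i j : ℚ) * x i * y j)
    (hpsd : ∀ x, 0 ≤ qQ x x)
    (mark : Fin (n + 1) → ℤ) (hmark : ∀ i, 0 < mark i) (hmark0 : mark 0 = 1)
    (hradZ : ∀ j, ∑ i, mark i * a i j = 0)
    (hrad : ∀ x : Fin (n + 1) → ℚ, qQ x x = 0 →
      ∃ c : ℚ, x = c • (fun i => (mark i : ℚ)))
    (hroot : ∀ m : Fin (n + 1) → ℤ, m 0 = 0 →
      (∑ i, ∑ j, a i j * m i * m j) = 2 →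
      ((∀ i, 0 ≤ m i) ∨ (∀ i, m i ≤ 0)) ∧ ∀ i, |m i| ≤ mark i)
    (r s : ℤ) (hr : 0 < r) (hs : 0 < s)
    (B : (Fin (n + 1) → ℤ) → (Fin (n + 1) → ℤ) → ℤ)
    (hB : ∀ x y, B x y = ∑ i, ∑ j, x i * y j * (-a i j + 2 * r * s))
    (H : Fin (n + 1) → ℤ) (hH : H = mark) :
    (∀ x : Fin (n + 1) → ℤ, B x H = 0 → x ≠ 0 → B x x < 0) ∧
    ¬∃ x : Fin (n + 1) → ℤ, B x H = 0 ∧ B x x = -2 := by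
  subst hH
  have hpos : 0 < ∑ i, H i := Finset.sum_pos (fun i _ => hmark i) Finset.univ_nonempty
  have sum_eq_zero (x : Fin (n + 1) → ℤ) (hx : B x H = 0) : ∑ i, x i = 0 := by
    rw [hB, sum_mul_neg_add_const, sum_mul_radical_right hsymm hradZ, sub_zero] at hx
    simpa [hr.ne', hs.ne', hpos.ne'] using hx
  have B_self (x : Fin (n + 1) → ℤ) (hx : B x H = 0) :
      B x x = -∑ i, ∑ j, a i j * x i * x j := by
    rw [hB, sum_mul_neg_add_const, sum_eq_zero x hx]
    ring
  have neg_def (x : Fin (n + 1) → ℤ) (hx : B x H = 0) (hne : x ≠ 0) : B x x < 0 := by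
    have cast_form : qQ (fun i => (x i : ℚ)) (fun i => (x i : ℚ)) =
        ((∑ i, ∑ j, a i j * x i * x j : ℤ) : ℚ) := by
      rw [hqQ]
      push_cast
      rfl
    have hnonneg : 0 ≤ ∑ i, ∑ j, a i j * x i * x j := by
      have := hpsd fun i => (x i : ℚ)
      rw [cast_form] at this
      exact_mod_cast this
    rw [B_self x hx, neg_lt_zero]
    refine lt_of_le_of_ne hnonneg fun hzero => hne ?_
    obtain ⟨c, hc⟩ := hrad (fun i => (x i : ℚ)) (by rw [cast_form, ← hzero, Int.cast_zero])
    have hcoord (i : Fin (n + 1)) : (x i : ℚ) = c * H i := congrFun hc i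
    have hc_sum : c * ((∑ i, H i : ℤ) : ℚ) = 0 := by
      rw [Int.cast_sum, Finset.mul_sum, ← Finset.sum_congr rfl fun i _ => hcoord i,
        ← Int.cast_sum, sum_eq_zero x hx, Int.cast_zero]
    have hc₀ : c = 0 := (mul_eq_zero.mp hc_sum).resolve_right (by exact_mod_cast hpos.ne')
    funext i
    simpa [hc₀] using hcoord i
  refine ⟨neg_def, ?_⟩
  rintro ⟨x, hx, hxx⟩
  have hnorm : ∑ i, ∑ j, a i j * x i * x j = 2 := by
    have := B_self x hx
    omega
  obtain ⟨hsign, hbound⟩ := hroot (fun i => x i - x 0 * H i) (by simp [hmark0])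
    ((sum_sub_mul_radical hsymm hradZ x (x 0)).trans hnorm)
  have hx₀ := eq_zero_of_sum_eq_zero_of_sub_mul_bounded hmark0 hmark (sum_eq_zero x hx) hsign hbound
  simp [hx₀] at hnorm
end
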